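/- arXiv:2506.13591 — 5 statements merged into one kernel-verified Lean document; each statement's English description precedes it below -/
import Mathlib

section
/- Reflexivity is transitive: if I, H, F are fractional ideals of R such that I is H-reflexive (I = H:(H:I)) and H is F-reflexive (H = F:(F:H)), then I is F-reflexive (I = F:(F:I)). -/
open scoped nonZeroDivisors

noncomputable section

/-- `x ∈ R` is integral over the ideal `I`: it satisfies an equation of integral
dependence over `I`, i.e. a monic polynomial whose coefficient in degree
`deg - i` lies in `I ^ i`. -/
def IsIntegralOverIdeal {R : Type*} [CommRing R] (I : Ideal R) (x : R) : Prop :=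
  ∃ p : Polynomial R, p.Monic ∧ (∀ i < p.natDegree, p.coeff i ∈ I ^ (p.natDegree - i)) ∧
    Polynomial.eval x p = 0

/-- The integral closure of the ideal `I`, viewed as an `R`-submodule of `Q(R)`. -/
def intCl (R : Type*) [CommRing R] (I : Ideal R) : Submodule R (FractionRing R) :=
  Submodule.span R (algebraMap R (FractionRing R) '' {r : R | IsIntegralOverIdeal I r})

/-- `J` is a reduction of `I`: `J ⊆ I` and `J I^n = I^(n+1)` for some `n`. -/
def IsIdealReduction {R : Type*} [CommRing R] (J I : Ideal R) : Prop :=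
  J ≤ I ∧ ∃ n : ℕ, J * I ^ n = I ^ (n + 1)

/-- `J` is a minimal reduction of `I`: no reduction of `I` is properly contained in `J`. -/
def IsMinimalReduction {R : Type*} [CommRing R] (J I : Ideal R) : Prop :=
  IsIdealReduction J I ∧ ∀ K : Ideal R, IsIdealReduction K I → K ≤ J → K = J

/-- The ideal `I` of `R`, viewed as an `R`-submodule of `Q(R)`. -/
def idl (R : Type*) [CommRing R] (I : Ideal R) : Submodule R (FractionRing R) :=
  Submodule.map (Algebra.linearMap R (FractionRing R)) I

/-- The integral closure `R̄` of `R` in `Q(R)`, as an `R`-submodule of `Q(R)`. -/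
def Rbar (R : Type*) [CommRing R] : Submodule R (FractionRing R) :=
  Subalgebra.toSubmodule (integralClosure R (FractionRing R))

/-- The condC `C = R : R̄`, as an `R`-submodule of `Q(R)`. -/
def condC (R : Type*) [CommRing R] : Submodule R (FractionRing R) :=
  1 / Rbar R

/-- The product `z • I` of a submodule `I` of `Q(R)` by an element `z ∈ Q(R)`. -/
def smulQ {R : Type*} [CommRing R] (z : FractionRing R)
    (I : Submodule R (FractionRing R)) : Submodule R (FractionRing R) :=
  Submodule.span R {z} * I

/-- `I` is a (regular) fractional ideal of `R`: it contains a regular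
(= invertible) element of `Q(R)`, and `yI ⊆ R` for some regular `y ∈ R`. -/
def IsFracIdeal {R : Type*} [CommRing R] (I : Submodule R (FractionRing R)) : Prop :=
  (∃ u : (FractionRing R)ˣ, (u : FractionRing R) ∈ I) ∧
    ∃ y ∈ R⁰, smulQ (algebraMap R (FractionRing R) y) I ≤ 1

/-- `z ∈ Q(R)` is a reduction of the fractional ideal `F`: `z = x/y` with `y`
regular in `R`, `yF ⊆ R`, and `(x)` a minimal reduction of the ideal `yF` of `R`. -/
def IsFracReduction {R : Type*} [CommRing R] (z : FractionRing R)
    (F : Submodule R (FractionRing R)) : Prop :=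
  ∃ x y : R, y ∈ R⁰ ∧
    z * algebraMap R (FractionRing R) y = algebraMap R (FractionRing R) x ∧
    smulQ (algebraMap R (FractionRing R) y) F ≤ 1 ∧
    IsMinimalReduction (Ideal.span {x})
      (Submodule.comap (Algebra.linearMap R (FractionRing R))
        (smulQ (algebraMap R (FractionRing R) y) F))

/-- Colon by a product is iterated colon: `(F : M) : K = F : (M K)`. -/
theorem Submodule.div_div_eq_div_mul {R A : Type*} [CommSemiring R] [CommSemiring A] [Algebra R A]
    (F M K : Submodule R A) : (F / M) / K = F / (M * K) := by
  apply le_antisymm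
  · rw [Submodule.le_div_iff_mul_le, mul_comm M K, ← mul_assoc, ← Submodule.le_div_iff_mul_le,
      ← Submodule.le_div_iff_mul_le]
  · rw [Submodule.le_div_iff_mul_le, Submodule.le_div_iff_mul_le, mul_assoc, mul_comm K M,
      ← Submodule.le_div_iff_mul_le]

/-- Every colon module `F : M` is `F`-reflexive. -/
theorem Submodule.div_div_div_cancel {R A : Type*} [CommSemiring R] [CommSemiring A] [Algebra R A]
    (F M : Submodule R A) : F / (F / (F / M)) = F / M := by
  apply le_antisymm
  · rw [Submodule.le_div_iff_mul_le]
    refine (mul_le_mul_right ?_ _).trans (Submodule.le_div_iff_mul_le.mp le_rfl)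
    rw [Submodule.le_div_iff_mul_le, mul_comm, ← Submodule.le_div_iff_mul_le]
  · rw [Submodule.le_div_iff_mul_le, mul_comm, ← Submodule.le_div_iff_mul_le]

theorem statement_14
    (R : Type*) [CommRing R] [IsNoetherianRing R] [IsLocalRing R] [IsReduced R]
    (hdim : ringKrullDim R = 1)
    (hCM : ∃ x ∈ IsLocalRing.maximalIdeal R, x ∈ R⁰)
    [Infinite (IsLocalRing.ResidueField R)]
    (hfin : (Subalgebra.toSubmodule (integralClosure R (FractionRing R))).FG)
    (I H F : Submodule R (FractionRing R))
    (hI : IsFracIdeal I) (hH : IsFracIdeal H) (hF : IsFracIdeal F)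
    (hIH : H / (H / I) = I) (hHF : F / (F / H) = H) :
    F / (F / I) = I := by
  have hI' : I = F / (F / H * (H / I)) := by
    rw [← Submodule.div_div_eq_div_mul, hHF, hIH]
  rw [hI', Submodule.div_div_div_cancel]
end
end

section
/- If I is an integrally closed regular ideal of R containing the conductor C, then the fractional ideal I:I is reflexive, i.e. R:(R:(I:I)) = I:I. -/
open scoped nonZeroDivisors

noncomputable section

/-- If `y` maps a finitely generated submodule `N` containing a unit into `I • N`, then `y` satisfies
an equation of integral dependence over `I`. -/
theorem exists_integral_equation_of_mul_mem {R A : Type*} [CommRing R] [CommRing A] [Algebra R A]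
    (I : Ideal R) (N : Submodule R A) (hN : N.FG) {u : A} (hu : IsUnit u) (huN : u ∈ N) (y : A)
    (hy : ∀ n ∈ N, y * n ∈ I • N) :
    ∃ p : Polynomial R, p.Monic ∧ (∀ i, p.coeff i ∈ I ^ (p.natDegree - i)) ∧
      Polynomial.aeval y p = 0 := by
  have : Module.Finite R N := Module.Finite.iff_fg.mpr hN
  have hyN : ∀ n ∈ N, LinearMap.mulLeft R y n ∈ N := fun n hn => Submodule.smul_le_right (hy n hn)
  obtain ⟨p, hp, -, hc, h0⟩ :=
    LinearMap.exists_monic_and_natDegree_eq_and_coeff_mem_pow_and_aeval_eq_zero R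
      ((LinearMap.mulLeft R y).restrict hyN) I (by
        rintro _ ⟨n, rfl⟩
        rw [Submodule.mem_smul_top_iff]
        exact hy n n.2)
  refine ⟨p, hp, hc, ?_⟩
  have hpow : ∀ n : ℕ, (((((LinearMap.mulLeft R y).restrict hyN) ^ n) ⟨u, huN⟩ : N) : A)
      = y ^ n * u := by
    intro n
    induction n with
    | zero => simp
    | succ n ih =>
      rw [pow_succ', Module.End.mul_apply, LinearMap.coe_restrict_apply, ih,
        LinearMap.mulLeft_apply, pow_succ', mul_assoc]
  have h1 := congrArg (fun f => ((f ⟨u, huN⟩ : N) : A)) h0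
  simp only [Polynomial.aeval_endomorphism, Polynomial.sum, Submodule.coe_sum, Submodule.coe_smul,
    hpow, LinearMap.zero_apply, Submodule.coe_zero] at h1
  rw [← hu.mul_left_eq_zero, Polynomial.aeval_def, Polynomial.eval₂_eq_sum, Polynomial.sum,
    Finset.sum_mul, ← h1]
  simp only [Algebra.smul_def, mul_assoc]

/-- In a ring of dimension at most one, a prime containing a regular element is maximal. -/
theorem isMaximal_of_mem_nonZeroDivisors {R : Type*} [CommRing R] [Ring.KrullDimLE 1 R]
    (p : Ideal R) [hp : p.IsPrime] {r : R} (hr : r ∈ R⁰) (hrp : r ∈ p) : p.IsMaximal :=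
  (Ring.krullDimLE_one_iff.mp ‹_› p hp).resolve_left fun h =>
    notMem_nonZeroDivisors_of_mem_mem_minimalPrimes hrp h hr

section

variable {R : Type*} [CommRing R]

theorem isUnit_algebraMap_of_mem_nonZeroDivisors {r : R} (hr : r ∈ R⁰) :
    IsUnit (algebraMap R (FractionRing R) r) :=
  IsLocalization.map_units (FractionRing R) (⟨r, hr⟩ : R⁰)

theorem one_mem_Rbar : (1 : FractionRing R) ∈ Rbar R := isIntegral_one

theorem mul_mem_Rbar {x y : FractionRing R} (hx : x ∈ Rbar R) (hy : y ∈ Rbar R) :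
    x * y ∈ Rbar R := IsIntegral.mul hx hy

theorem algebraMap_mem_idl {I : Ideal R} {a : R} (ha : a ∈ I) :
    algebraMap R (FractionRing R) a ∈ idl R I := ⟨a, ha, rfl⟩

theorem algebraMap_mem_Rbar (a : R) : algebraMap R (FractionRing R) a ∈ Rbar R :=
  isIntegral_algebraMap

/-- An element mapping a finitely generated submodule with a unit into itself is integral. -/
theorem mem_Rbar_of_mul_mem (N : Submodule R (FractionRing R)) (hN : N.FG) {u : FractionRing R}
    (hu : IsUnit u) (huN : u ∈ N) {y : FractionRing R} (hy : ∀ n ∈ N, y * n ∈ N) : y ∈ Rbar R := by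
  obtain ⟨p, hp, -, h0⟩ := exists_integral_equation_of_mul_mem ⊤ N hN hu huN y
    (fun n hn => by simpa using hy n hn)
  exact ⟨p, hp, by simpa [Polynomial.aeval_def] using h0⟩

theorem one_mem_Rbar_div_idl (I : Ideal R) : (1 : FractionRing R) ∈ Rbar R / idl R I := by
  rw [Submodule.mem_div_iff_forall_mul_mem]
  rintro _ ⟨a, -, rfl⟩
  simpa using algebraMap_mem_Rbar a

theorem mul_mem_Rbar_div_idl {I : Ideal R} {b m : FractionRing R} (hb : b ∈ Rbar R)
    (hm : m ∈ Rbar R / idl R I) : b * m ∈ Rbar R / idl R I := by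
  rw [Submodule.mem_div_iff_forall_mul_mem] at hm ⊢
  intro a ha
  rw [mul_assoc]
  exact mul_mem_Rbar hb (hm a ha)

theorem Rbar_div_idl_fg [IsNoetherianRing R] (hfin : (Rbar R).FG) {I : Ideal R} {r : R}
    (hrI : r ∈ I) (hr : r ∈ R⁰) : (Rbar R / idl R I).FG := by
  obtain ⟨u, hu⟩ := isUnit_algebraMap_of_mem_nonZeroDivisors hr
  have := isNoetherian_of_fg_of_noetherian _
    (hfin.map (LinearMap.mulLeft R ((u⁻¹ : (FractionRing R)ˣ) : FractionRing R)))
  refine isNoetherian_submodule.mp this _ fun m hm => ?_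
  refine ⟨m * u, ?_, ?_⟩
  · rw [hu]
    exact Submodule.mem_div_iff_forall_mul_mem.mp hm _ (algebraMap_mem_idl hrI)
  · rw [LinearMap.mulLeft_apply, mul_comm m, Units.inv_mul_cancel_left]

/-- `I (R̄ : I)`, as an ideal of `R̄`. -/
def invProdIdeal (I : Ideal R) : Ideal (integralClosure R (FractionRing R)) where
  carrier := {b | (b : FractionRing R) ∈ idl R I * (Rbar R / idl R I)}
  add_mem' := fun ha hb => (idl R I * (Rbar R / idl R I)).add_mem ha hb
  zero_mem' := (idl R I * (Rbar R / idl R I)).zero_mem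
  smul_mem' := by
    intro c x hx
    change (c : FractionRing R) * (x : FractionRing R) ∈ idl R I * (Rbar R / idl R I)
    refine Submodule.mul_induction_on hx (fun a ha m hm => ?_) (fun a b ha hb => ?_)
    · rw [mul_left_comm]
      exact Submodule.mul_mem_mul ha (mul_mem_Rbar_div_idl c.2 hm)
    · rw [mul_add]
      exact Submodule.add_mem _ ha hb

theorem mem_Rbar_of_mem_idl_mul {I : Ideal R} {x : FractionRing R}
    (hx : x ∈ idl R I * (Rbar R / idl R I)) : x ∈ Rbar R := by
  rw [mul_comm] at hx
  exact Submodule.mul_le.mpr (fun m hm a ha => Submodule.mem_div_iff_forall_mul_mem.mp hm a ha) hx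

/-- In dimension one, regular ideals generate invertible ideals of the integral closure. -/
theorem one_mem_idl_mul_Rbar_div [IsNoetherianRing R] [Ring.KrullDimLE 1 R] (hfin : (Rbar R).FG)
    {I : Ideal R} {r : R} (hrI : r ∈ I) (hr : r ∈ R⁰) :
    (1 : FractionRing R) ∈ idl R I * (Rbar R / idl R I) := by
  by_contra hne
  let B := integralClosure R (FractionRing R)
  have : Module.Finite R B := Module.Finite.iff_fg.mpr hfin
  have : IsNoetherianRing B := isNoetherian_of_tower R inferInstance
  have hK : invProdIdeal I ≠ ⊤ := fun h => hne ((Ideal.eq_top_iff_one _).mp h)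
  obtain ⟨P, hP, hKP⟩ := Ideal.exists_le_maximal _ hK
  have hrP : algebraMap R B r ∈ P := hKP <| by
    change algebraMap R (FractionRing R) r ∈ idl R I * (Rbar R / idl R I)
    simpa using Submodule.mul_mem_mul (algebraMap_mem_idl hrI) (one_mem_Rbar_div_idl I)
  have := hP.isPrime
  have hmin : P ∈ ((Ideal.span {algebraMap R B r}).colon {(1 : B)}).minimalPrimes := by
    have : (Ideal.span {algebraMap R B r}).colon {(1 : B)} = Ideal.span {algebraMap R B r} := by
      ext b; simp [Submodule.mem_colon_singleton]
    rw [this]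
    obtain ⟨q, hq, hqP⟩ := Ideal.exists_minimalPrimes_le
      ((Ideal.span_singleton_le_iff_mem P).mpr hrP)
    have := hq.isPrime
    have hrq : r ∈ q.comap (algebraMap R B) := (Ideal.span_singleton_le_iff_mem q).mp hq.1.2
    have hqmax := Ideal.isMaximal_of_isIntegral_of_isMaximal_comap (R := R) q
      (isMaximal_of_mem_nonZeroDivisors _ hr hrq)
    rwa [← hqmax.eq_of_le hP.ne_top hqP]
  obtain ⟨c, hc⟩ := Submodule.exists_eq_colon_of_mem_minimalPrimes hmin
  have hmemP : ∀ b : B, b ∈ P ↔ algebraMap R B r ∣ b * c := fun b => by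
    conv_lhs => rw [hc]
    rw [Submodule.mem_colon_singleton, Ideal.mem_span_singleton, smul_eq_mul]
  obtain ⟨u, hu⟩ := isUnit_algebraMap_of_mem_nonZeroDivisors hr
  let y : FractionRing R := (u⁻¹ : (FractionRing R)ˣ) * (c : FractionRing R)
  have hyP : ∀ b ∈ P, y * (b : FractionRing R) ∈ Rbar R := by
    intro b hb
    obtain ⟨d, hd⟩ := (hmemP b).mp hb
    have hd' : (b : FractionRing R) * c = u * d := by
      rw [hu]; exact congrArg Subtype.val hd
    have : y * b = d := by
      rw [mul_assoc, mul_comm (c : FractionRing R), hd', Units.inv_mul_cancel_left]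
    rw [this]
    exact d.2
  have hyM : ∀ m ∈ Rbar R / idl R I, y * m ∈ Rbar R / idl R I := by
    intro m hm
    rw [Submodule.mem_div_iff_forall_mul_mem]
    intro a ha
    have hma : a * m ∈ idl R I * (Rbar R / idl R I) := Submodule.mul_mem_mul ha hm
    rw [mul_assoc, mul_comm m]
    exact hyP ⟨a * m, mem_Rbar_of_mem_idl_mul hma⟩ (hKP hma)
  have hyB : y ∈ Rbar R := mem_Rbar_of_mul_mem _ (Rbar_div_idl_fg hfin hrI hr) isUnit_one
    (one_mem_Rbar_div_idl I) hyM
  apply hP.ne_top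
  rw [Ideal.eq_top_iff_one, hmemP]
  refine ⟨⟨y, hyB⟩, Subtype.ext ?_⟩
  change (1 : FractionRing R) * c = algebraMap R (FractionRing R) r * y
  rw [one_mul, ← hu, Units.mul_inv_cancel_left]

/-- The integral closure is reflexive. -/
theorem mem_Rbar_of_mul_condC_le [IsNoetherianRing R] (hfin : (Rbar R).FG) {x : FractionRing R}
    (hx : ∀ c ∈ condC R, x * c ∈ (1 : Submodule R (FractionRing R))) : x ∈ Rbar R := by
  obtain ⟨s, hs⟩ := hfin
  obtain ⟨d, hd⟩ := IsLocalization.exist_integer_multiples_of_finset R⁰ s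
  have hdC : algebraMap R (FractionRing R) d ∈ condC R := by
    refine Submodule.mem_div_iff_forall_mul_mem.mpr fun b hb => ?_
    rw [← hs] at hb
    refine Submodule.span_induction (fun b hb => ?_) ?_ (fun a b _ _ ha hb => ?_)
      (fun t b _ hb => ?_) hb
    · obtain ⟨a, ha⟩ := hd b hb
      exact Submodule.mem_one.mpr ⟨a, by rw [ha, Algebra.smul_def]⟩
    · simp
    · rw [mul_add]; exact Submodule.add_mem _ ha hb
    · rw [mul_smul_comm]; exact Submodule.smul_mem _ _ hb
  have hC1 : condC R ≤ 1 := fun c hc => by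
    simpa using Submodule.mem_div_iff_forall_mul_mem.mp hc 1 one_mem_Rbar
  have hCfg : (condC R).FG := by
    have := isNoetherian_of_fg_of_noetherian (1 : Submodule R (FractionRing R))
      (by rw [Submodule.one_eq_span]; exact Submodule.fg_span_singleton _)
    exact isNoetherian_submodule.mp this _ hC1
  refine mem_Rbar_of_mul_mem _ hCfg (isUnit_algebraMap_of_mem_nonZeroDivisors d.2) hdC
    fun c hc => Submodule.mem_div_iff_forall_mul_mem.mpr fun b hb => ?_
  rw [mul_assoc]
  refine hx _ (Submodule.mem_div_iff_forall_mul_mem.mpr fun b' hb' => ?_)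
  rw [mul_assoc]
  exact Submodule.mem_div_iff_forall_mul_mem.mp hc _ (mul_mem_Rbar hb hb')

/-- Regular integrally closed ideals are reflexive in dimension one. -/
theorem one_div_one_div_idl_le [IsNoetherianRing R] [Ring.KrullDimLE 1 R] (hfin : (Rbar R).FG)
    {I : Ideal R} {r : R} (hrI : r ∈ I) (hr : r ∈ R⁰)
    (hIic : ∀ r : R, IsIntegralOverIdeal I r → r ∈ I) :
    (1 : Submodule R (FractionRing R)) / (1 / idl R I) ≤ idl R I := by
  intro x hx
  rw [Submodule.mem_div_iff_forall_mul_mem] at hx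
  have h1 : (1 : FractionRing R) ∈ (1 : Submodule R (FractionRing R)) / idl R I := by
    refine Submodule.mem_div_iff_forall_mul_mem.mpr ?_
    rintro _ ⟨a, -, rfl⟩
    exact Submodule.mem_one.mpr ⟨a, by simp⟩
  obtain ⟨x, rfl⟩ := Submodule.mem_one.mp (by simpa using hx 1 h1)
  refine algebraMap_mem_idl (hIic x ?_)
  have hxM : ∀ m ∈ Rbar R / idl R I, algebraMap R (FractionRing R) x * m ∈ Rbar R := by
    refine fun m hm => mem_Rbar_of_mul_condC_le hfin fun c hc => ?_
    rw [mul_assoc]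
    refine hx _ (Submodule.mem_div_iff_forall_mul_mem.mpr fun a ha => ?_)
    rw [mul_comm m, mul_assoc]
    exact Submodule.mem_div_iff_forall_mul_mem.mp hc _
      (Submodule.mem_div_iff_forall_mul_mem.mp hm a ha)
  have hxB : ∀ b ∈ Rbar R, algebraMap R (FractionRing R) x * b ∈ I • Rbar R := by
    intro b hb
    have key : ∀ z ∈ idl R I * (Rbar R / idl R I),
        algebraMap R (FractionRing R) x * (b * z) ∈ I • Rbar R := by
      intro z hz
      refine Submodule.mul_induction_on hz ?_ (fun z w hz hw => ?_)
      · rintro _ ⟨a, ha, rfl⟩ m hm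
        have := Submodule.smul_mem_smul ha (mul_mem_Rbar hb (hxM m hm))
        rw [Algebra.smul_def] at this
        convert this using 1
        rw [Algebra.linearMap_apply]
        ring
      · rw [mul_add, mul_add]; exact Submodule.add_mem _ hz hw
    simpa using key 1 (one_mem_idl_mul_Rbar_div hfin hrI hr)
  obtain ⟨p, hp, hc, h0⟩ := exists_integral_equation_of_mul_mem I (Rbar R) hfin isUnit_one
    one_mem_Rbar _ hxB
  refine ⟨p, hp, fun i _ => hc i, IsFractionRing.injective R (FractionRing R) ?_⟩
  rw [map_zero, ← h0, Polynomial.aeval_algebraMap_apply, Polynomial.coe_aeval_eq_eval]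

end

theorem statement_15
    (R : Type*) [CommRing R] [IsNoetherianRing R] [IsLocalRing R] [IsReduced R]
    (hdim : ringKrullDim R = 1)
    (hCM : ∃ x ∈ IsLocalRing.maximalIdeal R, x ∈ R⁰)
    [Infinite (IsLocalRing.ResidueField R)]
    (hfin : (Subalgebra.toSubmodule (integralClosure R (FractionRing R))).FG)
    (I : Ideal R) (hIreg : ∃ r ∈ I, r ∈ R⁰)
    (hIic : ∀ r : R, IsIntegralOverIdeal I r → r ∈ I)
    (hCI : condC R ≤ idl R I) :
    (1 : Submodule R (FractionRing R)) / (1 / (idl R I / idl R I)) = idl R I / idl R I := by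
  obtain ⟨r, hrI, hr⟩ := hIreg
  have : Ring.KrullDimLE 1 R := Ring.krullDimLE_iff.mpr (by rw [hdim]; rfl)
  apply le_antisymm
  · intro t ht
    rw [Submodule.mem_div_iff_forall_mul_mem] at ht ⊢
    intro a ha
    refine one_div_one_div_idl_le hfin hrI hr hIic
      (Submodule.mem_div_iff_forall_mul_mem.mpr fun b hb => ?_)
    rw [mul_assoc]
    refine ht _ (Submodule.mem_div_iff_forall_mul_mem.mpr fun e he => ?_)
    rw [mul_comm a, mul_assoc, mul_comm a]
    exact Submodule.mem_div_iff_forall_mul_mem.mp hb _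
      (Submodule.mem_div_iff_forall_mul_mem.mp he a ha)
  · intro t ht
    refine Submodule.mem_div_iff_forall_mul_mem.mpr fun s hs => ?_
    rw [mul_comm]
    exact Submodule.mem_div_iff_forall_mul_mem.mp hs t ht
end
end

section
/- Let B = 𝔪:𝔪. The set 𝔪(𝔪:𝔪²) is an ideal of the ring B, and the maximal ideal 𝔪 is stable (i.e. 𝔪² = x𝔪 for some x ∈ 𝔪) if and only if 𝔪(𝔪:𝔪²) = B. -/
open scoped nonZeroDivisors

noncomputable section

/-- The endomorphism ring `M : M` of a submodule `M` of a commutative algebra, as a subalgebra. -/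
def Submodule.endSubalgebra {R A : Type*} [CommRing R] [CommRing A] [Algebra R A]
    (M : Submodule R A) : Subalgebra R A :=
  (M / M).toSubalgebra
    (Submodule.mem_div_iff_forall_mul_mem.2 fun y hy ↦ by rwa [one_mul])
    fun x y hx hy ↦ Submodule.mem_div_iff_forall_mul_mem.2 fun z hz ↦ by
      rw [mul_assoc]
      exact Submodule.mem_div_iff_forall_mul_mem.1 hx _
        (Submodule.mem_div_iff_forall_mul_mem.1 hy z hz)

theorem Submodule.mem_endSubalgebra {R A : Type*} [CommRing R] [CommRing A] [Algebra R A]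
    {M : Submodule R A} {x : A} : x ∈ M.endSubalgebra ↔ ∀ y ∈ M, x * y ∈ M :=
  Submodule.mem_div_iff_forall_mul_mem

/-- If `M` is finitely generated over a noetherian ring and contains a unit, then `M : M` is a
finite algebra. -/
theorem Submodule.finite_endSubalgebra {R A : Type*} [CommRing R] [IsNoetherianRing R]
    [CommRing A] [Algebra R A] {M : Submodule R A} (hM : M.FG) {y : A} (hy : y ∈ M)
    (hu : IsUnit y) : Module.Finite R M.endSubalgebra := by
  have : Module.Finite R M := Module.Finite.iff_fg.2 hM
  let f : M.endSubalgebra →ₗ[R] M :=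
    ((LinearMap.mulRight R y).comp M.endSubalgebra.val.toLinearMap).codRestrict M
      fun x ↦ Submodule.mem_endSubalgebra.1 x.2 y hy
  refine Module.Finite.of_injective f fun a b hab ↦ Subtype.ext (hu.mul_left_injective ?_)
  exact congrArg Subtype.val hab

/-- A finite algebra over a local ring is semilocal. -/
theorem finite_maximalSpectrum_of_finite (R S : Type*) [CommRing R] [IsLocalRing R] [CommRing S]
    [Algebra R S] [Module.Finite R S] : Finite (MaximalSpectrum S) := by
  have hfin := Algebra.QuasiFinite.finite_primesOver (S := S) (IsLocalRing.maximalIdeal R)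
  have := hfin.to_subtype
  refine Finite.of_injective
    (β := (IsLocalRing.maximalIdeal R).primesOver S) (fun P ↦ ⟨P.1, P.2.isPrime, ⟨?_⟩⟩) ?_
  · have := P.2
    exact (IsLocalRing.eq_maximalIdeal
      (Ideal.isMaximal_comap_of_isIntegral_of_isMaximal (R := R) P.1)).symm
  · intro P Q h
    exact MaximalSpectrum.ext (congrArg Subtype.val h)

/-- An invertible submodule over a semilocal ring is generated by one element. -/
theorem Submodule.exists_span_singleton_eq_of_isUnit {B A : Type*} [CommRing B]
    [Finite (MaximalSpectrum B)] [CommRing A] [Algebra B A] [FaithfulSMul B A]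
    {M : Submodule B A} (hM : IsUnit M) : ∃ z : A, Submodule.span B {z} = M := by
  obtain ⟨u, rfl⟩ := hM
  have hu : u ∈ (Submodule.unitsToPic B A).ker := Subsingleton.elim _ _
  rw [Submodule.ker_unitsToPic] at hu
  obtain ⟨z, rfl⟩ := hu
  exact ⟨z, rfl⟩

/-- If `M` is a module over a semilocal subalgebra `B` and `M * N = B` for a `B`-module `N`, then
`M = zB` for some `z ∈ M`. -/
theorem Submodule.exists_eq_mul_of_mul_eq_subalgebra {R A : Type*} [CommRing R] [CommRing A]
    [Algebra R A] (B : Subalgebra R A) [Finite (MaximalSpectrum B)] {M N : Submodule R A}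
    (hM : ∀ b ∈ B, ∀ x ∈ M, b * x ∈ M) (hN : ∀ b ∈ B, ∀ x ∈ N, b * x ∈ N)
    (hMN : M * N = Subalgebra.toSubmodule B) :
    ∃ z ∈ M, ∀ x ∈ M, ∃ b ∈ B, b * z = x := by
  let M' : Submodule B A := { M with smul_mem' := fun b x hx ↦ hM b b.2 x hx }
  let N' : Submodule B A := { N with smul_mem' := fun b x hx ↦ hN b b.2 x hx }
  have hM'N' : M' * N' = 1 := by
    apply le_antisymm
    · refine Submodule.mul_le.2 fun x hx y hy ↦ Submodule.mem_one.2 ?_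
      have : x * y ∈ Subalgebra.toSubmodule B := hMN ▸ Submodule.mul_mem_mul hx hy
      exact ⟨⟨_, this⟩, rfl⟩
    · have hle : ∀ a ∈ M * N, a ∈ M' * N' := fun a ha ↦
        Submodule.mul_induction_on ha
          (fun x hx y hy ↦ Submodule.mul_mem_mul (M := M') (N := N') hx hy)
          fun _ _ ↦ add_mem
      exact Submodule.one_le.2 (hle 1 (hMN ▸ one_mem B))
  obtain ⟨z, hz⟩ := Submodule.exists_span_singleton_eq_of_isUnit (IsUnit.of_mul_eq_one _ hM'N')
  refine ⟨z, (hz ▸ Submodule.mem_span_singleton_self z : z ∈ M'), fun x hx ↦ ?_⟩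
  obtain ⟨b, hb⟩ := Submodule.mem_span_singleton.1 (hz ▸ hx : x ∈ Submodule.span B {z})
  exact ⟨b, b.2, hb⟩

theorem algebraMap_mem_idl_iff {R : Type*} [CommRing R] {I : Ideal R} {x : R} :
    algebraMap R (FractionRing R) x ∈ idl R I ↔ x ∈ I := by
  refine ⟨fun ⟨y, hy, hyx⟩ ↦ ?_, fun hx ↦ ⟨x, hx, rfl⟩⟩
  rwa [← IsFractionRing.injective R (FractionRing R) hyx]

theorem idl_mul {R : Type*} [CommRing R] (I J : Ideal R) : idl R (I * J) = idl R I * idl R J :=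
  Submodule.map_mul I J (Algebra.ofId R (FractionRing R))

theorem statement_16
    (R : Type*) [CommRing R] [IsNoetherianRing R] [IsLocalRing R] [IsReduced R]
    (hdim : ringKrullDim R = 1)
    (hCM : ∃ x ∈ IsLocalRing.maximalIdeal R, x ∈ R⁰)
    [Infinite (IsLocalRing.ResidueField R)]
    (hfin : (Subalgebra.toSubmodule (integralClosure R (FractionRing R))).FG)
    :
    (idl R (IsLocalRing.maximalIdeal R) *
        (idl R (IsLocalRing.maximalIdeal R) /
          (idl R (IsLocalRing.maximalIdeal R) * idl R (IsLocalRing.maximalIdeal R))) ≤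
      idl R (IsLocalRing.maximalIdeal R) / idl R (IsLocalRing.maximalIdeal R)) ∧
    ((idl R (IsLocalRing.maximalIdeal R) / idl R (IsLocalRing.maximalIdeal R)) *
        (idl R (IsLocalRing.maximalIdeal R) *
          (idl R (IsLocalRing.maximalIdeal R) /
            (idl R (IsLocalRing.maximalIdeal R) * idl R (IsLocalRing.maximalIdeal R)))) ≤
      idl R (IsLocalRing.maximalIdeal R) *
        (idl R (IsLocalRing.maximalIdeal R) /
          (idl R (IsLocalRing.maximalIdeal R) * idl R (IsLocalRing.maximalIdeal R)))) ∧
    ((∃ x ∈ IsLocalRing.maximalIdeal R,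
        IsLocalRing.maximalIdeal R ^ 2 = Ideal.span {x} * IsLocalRing.maximalIdeal R) ↔
      idl R (IsLocalRing.maximalIdeal R) *
          (idl R (IsLocalRing.maximalIdeal R) /
            (idl R (IsLocalRing.maximalIdeal R) * idl R (IsLocalRing.maximalIdeal R))) =
        idl R (IsLocalRing.maximalIdeal R) / idl R (IsLocalRing.maximalIdeal R)) := by
  set m := IsLocalRing.maximalIdeal R
  set M := idl R m with hMdef
  obtain ⟨y, hym, hy⟩ := hCM
  have hle : M * (M / (M * M)) ≤ M / M := by
    refine Submodule.mul_le.2 fun a ha d hd ↦ Submodule.mem_div_iff_forall_mul_mem.2 fun c hc ↦ ?_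
    rw [mul_comm a d, mul_assoc]
    exact Submodule.mem_div_iff_forall_mul_mem.1 hd _ (Submodule.mul_mem_mul ha hc)
  have hBM : M / M * M ≤ M := Submodule.mul_le.2 fun b hb x hx ↦
    Submodule.mem_div_iff_forall_mul_mem.1 hb x hx
  have hBMM : M / M * (M * M) ≤ M * M := by
    rw [← mul_assoc]
    exact mul_le_mul_left hBM _
  have hideal : M / M * (M * (M / (M * M))) ≤ M * (M / (M * M)) := by
    rw [← mul_assoc]
    exact mul_le_mul_left hBM _
  refine ⟨hle, hideal, fun ⟨x, hx, hxm⟩ ↦ le_antisymm hle ?_, fun h ↦ ?_⟩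
  · have hxreg : x ∈ R⁰ := by
      have hyy : y * y ∈ Ideal.span {x} * m := hxm ▸ sq m ▸ Ideal.mul_mem_mul hym hym
      obtain ⟨z, -, hz⟩ := Ideal.mem_span_singleton_mul.1 hyy
      exact (mul_mem_nonZeroDivisors.1 (hz ▸ mul_mem hy hy)).1
    obtain ⟨u, hu⟩ := IsLocalization.map_units (FractionRing R) (⟨x, hxreg⟩ : R⁰)
    have hinv : (↑u⁻¹ : FractionRing R) ∈ M / (M * M) := by
      refine Submodule.mem_div_iff_forall_mul_mem.2 fun w hw ↦ ?_
      rw [hMdef, ← idl_mul, ← sq, hxm] at hw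
      obtain ⟨v, hv, rfl⟩ := hw
      obtain ⟨t, ht, rfl⟩ := Ideal.mem_span_singleton_mul.1 hv
      rw [Algebra.linearMap_apply, map_mul, ← hu, Units.inv_mul_cancel_left]
      exact algebraMap_mem_idl_iff.2 ht
    have hone : (1 : FractionRing R) ∈ M * (M / (M * M)) := by
      rw [← u.mul_inv, hu]
      exact Submodule.mul_mem_mul (algebraMap_mem_idl_iff.2 hx) hinv
    intro b hb
    simpa using hideal (Submodule.mul_mem_mul hb hone)
  · have hfg : M.FG := (IsNoetherian.noetherian m).map _
    have := Submodule.finite_endSubalgebra hfg (algebraMap_mem_idl_iff.2 hym)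
      (IsLocalization.map_units (FractionRing R) (⟨y, hy⟩ : R⁰))
    have := finite_maximalSpectrum_of_finite R M.endSubalgebra
    obtain ⟨z, hzM, hz⟩ := Submodule.exists_eq_mul_of_mul_eq_subalgebra M.endSubalgebra
      (M := M) (N := M / (M * M)) (fun b hb x hx ↦ Submodule.mem_endSubalgebra.1 hb x hx)
      (fun b hb x hx ↦ Submodule.mem_div_iff_forall_mul_mem.2 fun w hw ↦ by
        rw [mul_assoc, mul_left_comm]
        refine Submodule.mem_div_iff_forall_mul_mem.1 hx _ ?_
        exact hBMM (Submodule.mul_mem_mul hb hw)) h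
    obtain ⟨x, hx, rfl⟩ := hzM
    refine ⟨x, hx, le_antisymm ?_ ?_⟩
    · rw [sq]
      refine Ideal.mul_le.2 fun a ha c hc ↦ Ideal.mem_span_singleton_mul.2 ?_
      obtain ⟨b, hb, hba⟩ := hz _ (algebraMap_mem_idl_iff.2 ha)
      obtain ⟨t, ht, htbc⟩ := Submodule.mem_endSubalgebra.1 hb _ (algebraMap_mem_idl_iff.2 hc)
      refine ⟨t, ht, IsFractionRing.injective R (FractionRing R) ?_⟩
      rw [Algebra.linearMap_apply] at htbc hba
      rw [map_mul, map_mul, htbc, ← hba]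
      ring
    · rw [sq]
      exact Ideal.mul_mono_left ((Ideal.span_singleton_le_iff_mem _).2 hx)
end
end

section
/- Let B = 𝔪:𝔪. The following are equivalent: (1) R has minimal multiplicity (equivalently, 𝔪 is stable: 𝔪² = x𝔪 for some x ∈ 𝔪); (2) for any non-principal fractional ideal I of R, I is reflexive if and only if I is a B-reflexive fractional ideal of B; (3) 𝔪 is B-reflexive, i.e. 𝔪 = B:(B:𝔪). -/
open scoped nonZeroDivisors

noncomputable section

namespace MinimalMultiplicity

theorem isMaximal_of_mem_nonZeroDivisors {R : Type*} [CommRing R] [IsNoetherianRing R]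
    [Ring.KrullDimLE 1 R] {a : R} (ha : a ∈ R⁰) (p : Ideal R) [p.IsPrime] (hap : a ∈ p) :
    p.IsMaximal := by
  have hart : IsArtinian R (R ⧸ Ideal.span {a}) :=
    (isFiniteLength_iff_isNoetherian_isArtinian.1 (isFiniteLength_quotient_span_singleton R ha)).2
  have hle : Ideal.span {a} ≤ p := (Ideal.span_singleton_le_iff_mem p).2 hap
  have : IsArtinian R (R ⧸ p) :=
    isArtinian_of_surjective (f := Submodule.mapQ (Ideal.span {a}) p LinearMap.id hle) _ <| by
      intro y
      obtain ⟨r, rfl⟩ := Submodule.Quotient.mk_surjective _ y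
      exact ⟨Submodule.Quotient.mk r, rfl⟩
  have : IsArtinianRing (R ⧸ p) := isArtinian_of_tower R this
  exact Ideal.Quotient.maximal_of_isField p (IsArtinianRing.isField_of_isDomain _)

/-- A proper ideal of `B` containing a nonzerodivisor of the one-dimensional ring `R`, over which
`B` is finite, has an element of `Q` outside `B` in its dual. -/
theorem exists_notMem_range_forall_mul_mem {R B Q : Type*} [CommRing R] [IsNoetherianRing R]
    [Ring.KrullDimLE 1 R] [CommRing B] [Algebra R B] [Module.Finite R B] [CommRing Q] [Algebra B Q]
    (hinj : Function.Injective (algebraMap B Q)) {a : R} (ha : a ∈ R⁰)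
    (haQ : IsUnit (algebraMap B Q (algebraMap R B a))) {K : Ideal B} (hK : K ≠ ⊤)
    (haK : algebraMap R B a ∈ K) :
    ∃ q : Q, q ∉ (algebraMap B Q).range ∧ ∀ k ∈ K, q * algebraMap B Q k ∈ (algebraMap B Q).range := by
  have : IsNoetherianRing B := IsNoetherianRing.of_finite R B
  obtain ⟨P, hP, hKP⟩ := Ideal.exists_le_maximal K hK
  have hmem : P ∈ (Module.annihilator B (B ⧸ Ideal.span {algebraMap R B a})).minimalPrimes := by
    rw [Ideal.annihilator_quotient]
    refine ⟨⟨hP.isPrime, (Ideal.span_singleton_le_iff_mem P).2 (hKP haK)⟩, ?_⟩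
    rintro p ⟨hp, hap⟩ hpP
    have := isMaximal_of_mem_nonZeroDivisors ha (p.comap (algebraMap R B))
      ((Ideal.span_singleton_le_iff_mem p).1 hap)
    have := Ideal.isMaximal_of_isIntegral_of_isMaximal_comap (R := R) p this
    exact (this.eq_of_le hP.ne_top hpP).ge
  have hass := Module.associatedPrimes.minimalPrimes_annihilator_subset_associatedPrimes B _ hmem
  obtain ⟨-, x, hx⟩ := isAssociatedPrime_iff.1 hass
  obtain ⟨b, rfl⟩ := Ideal.Quotient.mk_surjective x
  have hcol (k : B) : k ∈ P ↔ k * b ∈ Ideal.span {algebraMap R B a} := by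
    rw [hx, Submodule.mem_colon_singleton, Submodule.mem_bot, ← Ideal.Quotient.eq_zero_iff_mem,
      map_mul]
    rfl
  obtain ⟨u, hu⟩ := haQ
  refine ⟨algebraMap B Q b * ↑u⁻¹, ?_, fun k hk => ?_⟩
  · rintro ⟨c, hc⟩
    apply hP.ne_top
    rw [Ideal.eq_top_iff_one, hcol, one_mul, Ideal.mem_span_singleton]
    refine ⟨c, hinj ?_⟩
    rw [map_mul, hc, ← hu, mul_comm, mul_assoc, Units.inv_mul, mul_one]
  · obtain ⟨c, hc⟩ := Ideal.mem_span_singleton.1 ((hcol k).1 (hKP hk))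
    refine ⟨c, ?_⟩
    have := congrArg (algebraMap B Q) hc
    rw [map_mul, map_mul, ← hu] at this
    calc algebraMap B Q c = ↑u⁻¹ * (↑u * algebraMap B Q c) := by simp
      _ = _ := by rw [← this]; ring

theorem finite_setOf_isMaximal (R B : Type*) [CommRing R] [IsLocalRing R] [CommRing B] [Algebra R B]
    [Module.Finite R B] : {I : Ideal B | I.IsMaximal}.Finite := by
  refine (Algebra.QuasiFinite.finite_primesOver (S := B) (IsLocalRing.maximalIdeal R)).subset ?_
  intro I hI
  have : I.IsMaximal := hI
  exact ⟨hI.isPrime,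
    ⟨(IsLocalRing.eq_maximalIdeal (Ideal.isMaximal_comap_of_isIntegral_of_isMaximal I)).symm⟩⟩

variable {R : Type*} [CommRing R]

theorem isUnit_algebraMap_fractionRing {a : R} (ha : a ∈ R⁰) :
    IsUnit (algebraMap R (FractionRing R) a) :=
  IsLocalization.map_units (FractionRing R) (⟨a, ha⟩ : R⁰)

theorem isLocalization_algebraMapSubmonoid (B : Subalgebra R (FractionRing R)) :
    IsLocalization (Algebra.algebraMapSubmonoid B R⁰) (FractionRing R) where
  map_units := by
    rintro ⟨_, a, ha, rfl⟩
    exact isUnit_algebraMap_fractionRing ha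
  surj z := by
    obtain ⟨⟨r, s⟩, h⟩ := IsLocalization.surj R⁰ z
    exact ⟨⟨algebraMap R B r, ⟨_, s, s.2, rfl⟩⟩, h⟩
  exists_of_eq h := ⟨1, by rw [Subtype.coe_injective h]⟩

/-- Over a local ring, an overring that is a finite module has only principal invertible
fractional ideals. -/
theorem exists_eq_span_singleton_of_mul_eq_one [IsLocalRing R] (B : Subalgebra R (FractionRing R))
    [Module.Finite R B] (M J : Submodule B (FractionRing R)) {a : R} (ha : a ∈ R⁰)
    (hM : M ≤ 1) (haM : algebraMap R (FractionRing R) a ∈ M) (hMJ : M * J = 1) :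
    ∃ x, M = Submodule.span B {x} := by
  have := isLocalization_algebraMapSubmonoid B
  let S := Algebra.algebraMapSubmonoid B R⁰
  have hS : S ≤ B⁰ := by
    rintro _ ⟨s, hs, rfl⟩
    rw [mem_nonZeroDivisors_iff_right]
    intro z hz
    apply Subtype.coe_injective
    have := congrArg (Subtype.val) hz
    exact (isUnit_algebraMap_fractionRing hs).mul_left_eq_zero.1 this
  have hM' : IsFractional S M := ⟨1, S.one_mem, fun b hb => by
    rw [one_smul]
    obtain ⟨y, hy⟩ := Submodule.mem_one.1 (hM hb)
    exact ⟨y, hy⟩⟩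
  have hJ' : IsFractional S J := ⟨algebraMap R B a, ⟨a, ha, rfl⟩, fun b hb => by
    obtain ⟨y, hy⟩ := Submodule.mem_one.1 (hMJ ▸ Submodule.mul_mem_mul haM hb)
    exact ⟨y, hy⟩⟩
  let I : FractionalIdeal S (FractionRing R) := ⟨M, hM'⟩
  let I' : FractionalIdeal S (FractionRing R) := ⟨J, hJ'⟩
  have hII' : I * I' = 1 := by
    rw [FractionalIdeal.coe_ext_iff, FractionalIdeal.coe_mul, FractionalIdeal.coe_one]
    exact hMJ
  obtain ⟨x, hx⟩ := FractionalIdeal.isPrincipal.of_finite_maximals_of_inv hS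
    (finite_setOf_isMaximal R B) I I' hII'
  exact ⟨x, hx⟩

/-- The multiplier ring `M : M` of a submodule `M` of `Q(R)`. -/
def multiplierRing (M : Submodule R (FractionRing R)) : Subalgebra R (FractionRing R) where
  carrier := {z | z ∈ M / M}
  mul_mem' {a b} ha hb y hy := by
    rw [mul_assoc]
    exact ha _ (hb y hy)
  add_mem' := (M / M).add_mem
  algebraMap_mem' r y hy := by
    rw [← Algebra.smul_def]
    exact M.smul_mem r hy

theorem finite_multiplierRing [IsNoetherianRing R] {M : Submodule R (FractionRing R)} (hM : M ≤ 1)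
    {a : R} (ha : a ∈ R⁰) (haM : algebraMap R (FractionRing R) a ∈ M) :
    Module.Finite R (multiplierRing M) := by
  obtain ⟨u, hu⟩ := isUnit_algebraMap_fractionRing ha
  have hle : Subalgebra.toSubmodule (multiplierRing M) ≤ Submodule.span R {(↑u⁻¹ : FractionRing R)} := by
    intro z hz
    obtain ⟨r, hr⟩ := Submodule.mem_one.1 (hM (hz _ haM))
    refine Submodule.mem_span_singleton.2 ⟨r, ?_⟩
    rw [Algebra.smul_def, hr, ← hu, mul_assoc, Units.mul_inv, mul_one]
  have : IsNoetherian R (Submodule.span R {(↑u⁻¹ : FractionRing R)}) :=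
    isNoetherian_span_of_finite R (Set.finite_singleton _)
  have := isNoetherian_of_le hle
  exact Module.IsNoetherian.finite R (Subalgebra.toSubmodule (multiplierRing M))

theorem idl_le_one (I : Ideal R) : idl R I ≤ 1 := by
  rintro _ ⟨r, -, rfl⟩
  exact Submodule.mem_one.2 ⟨r, rfl⟩

theorem algebraMap_mem_idl {I : Ideal R} {r : R} :
    algebraMap R (FractionRing R) r ∈ idl R I ↔ r ∈ I := by
  refine ⟨?_, fun h => ⟨r, h, rfl⟩⟩
  rintro ⟨s, hs, h⟩
  rwa [← IsFractionRing.injective R (FractionRing R) h]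

theorem sq_eq_span_singleton_mul {I : Ideal R} {r : R} (hr : r ∈ I)
    (h : ∀ y ∈ idl R I, ∃ b ∈ idl R I / idl R I, y = b * algebraMap R (FractionRing R) r) :
    I ^ 2 = Ideal.span {r} * I := by
  rw [pow_two]
  apply le_antisymm
  · rw [Ideal.mul_le]
    intro y hy z hz
    obtain ⟨b, hb, hyb⟩ := h _ (algebraMap_mem_idl.2 hy)
    obtain ⟨w, hw, hwb⟩ := hb _ (algebraMap_mem_idl.2 hz)
    refine Ideal.mem_span_singleton_mul.2 ⟨w, hw, IsFractionRing.injective R (FractionRing R) ?_⟩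
    change algebraMap R (FractionRing R) w = _ at hwb
    rw [map_mul, map_mul, hyb, hwb]
    ring
  · exact Ideal.mul_mono_left ((Ideal.span_singleton_le_iff_mem I).2 hr)

theorem mul_inv_mem_div_of_sq_eq {I : Ideal R} {r : R} (h : I ^ 2 = Ideal.span {r} * I)
    {u : (FractionRing R)ˣ} (hu : (u : FractionRing R) = algebraMap R (FractionRing R) r)
    {y : FractionRing R} (hy : y ∈ idl R I) : y * ↑u⁻¹ ∈ idl R I / idl R I := by
  rintro _ ⟨z, hz, rfl⟩
  obtain ⟨y, hy, rfl⟩ := hy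
  have hyz : y * z ∈ Ideal.span {r} * I := by
    rw [← h, pow_two]
    exact Ideal.mul_mem_mul hy hz
  obtain ⟨w, hw, hwr⟩ := Ideal.mem_span_singleton_mul.1 hyz
  refine ⟨w, hw, ?_⟩
  have := congrArg (algebraMap R (FractionRing R)) hwr
  rw [map_mul, map_mul, ← hu] at this
  change algebraMap R (FractionRing R) w =
    algebraMap R (FractionRing R) y * ↑u⁻¹ * algebraMap R (FractionRing R) z
  rw [mul_right_comm, ← this, mul_right_comm, Units.mul_inv, one_mul]

theorem mem_nonZeroDivisors_of_sq_eq {I : Ideal R} {a r : R} (ha : a ∈ R⁰) (haI : a ∈ I)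
    (h : I ^ 2 = Ideal.span {r} * I) : r ∈ R⁰ := by
  have haa : a * a ∈ Ideal.span {r} * I := by
    rw [← h, pow_two]
    exact Ideal.mul_mem_mul haI haI
  obtain ⟨w, -, hw⟩ := Ideal.mem_span_singleton_mul.1 haa
  have : r * w ∈ R⁰ := hw ▸ mul_mem ha ha
  exact (mul_mem_nonZeroDivisors.1 this).1

theorem one_div_le_div_of_not_principal [IsLocalRing R] {I : Submodule R (FractionRing R)}
    (hI : ¬∃ x, I = Submodule.span R {x}) :
    1 / I ≤ idl R (IsLocalRing.maximalIdeal R) / I := by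
  intro z hz i hi
  obtain ⟨r, hr⟩ := Submodule.mem_one.1 (hz i hi)
  by_cases h : r ∈ IsLocalRing.maximalIdeal R
  · exact ⟨r, h, hr⟩
  · obtain ⟨v, rfl⟩ := IsLocalRing.notMem_maximalIdeal.1 h
    refine (hI ⟨i, le_antisymm ?_ ((Submodule.span_singleton_le_iff_mem i I).2 hi)⟩).elim
    intro y hy
    obtain ⟨s, hs⟩ := Submodule.mem_one.1 (hz y hy)
    refine Submodule.mem_span_singleton.2 ⟨↑v⁻¹ * s, ?_⟩
    rw [Algebra.smul_def, map_mul, hs]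
    calc algebraMap R (FractionRing R) ↑v⁻¹ * (z * y) * i
        = algebraMap R (FractionRing R) ↑v⁻¹ * (z * i) * y := by ring
      _ = y := by rw [← hr, ← map_mul, Units.inv_mul, map_one, one_mul]

theorem one_mem_div_self (I : Submodule R (FractionRing R)) : (1 : FractionRing R) ∈ I / I :=
  fun y hy => by rwa [one_mul]

theorem one_le_div_self (I : Submodule R (FractionRing R)) : 1 ≤ I / I :=
  Submodule.one_le.2 (one_mem_div_self I)

theorem div_self_eq_one_of_eq_span_singleton {M : Submodule R (FractionRing R)}
    {u : (FractionRing R)ˣ} (hu : (u : FractionRing R) ∈ M) {x : FractionRing R}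
    (hx : M = Submodule.span R {x}) : M / M = 1 := by
  refine le_antisymm (fun z hz => ?_) (one_le_div_self M)
  obtain ⟨s, hs⟩ := Submodule.mem_span_singleton.1 (hx ▸ hu)
  have hxu : IsUnit x := by
    refine isUnit_of_mul_isUnit_right (x := algebraMap R (FractionRing R) s) ?_
    rw [← Algebra.smul_def, hs]
    exact u.isUnit
  have hxM : x ∈ M := hx ▸ Submodule.mem_span_singleton_self x
  have hzx : z * x ∈ Submodule.span R {x} := hx ▸ hz x hxM
  obtain ⟨t, ht⟩ := Submodule.mem_span_singleton.1 hzx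
  refine Submodule.mem_one.2 ⟨t, hxu.mul_right_cancel ?_⟩
  rw [← ht, Algebra.smul_def]

variable [IsLocalRing R]

local notation "𝔐" => idl R (IsLocalRing.maximalIdeal R)

theorem div_div_maximalIdeal_of_sq_eq {r : R} (hr : r ∈ R⁰) (hrm : r ∈ IsLocalRing.maximalIdeal R)
    (h : IsLocalRing.maximalIdeal R ^ 2 = Ideal.span {r} * IsLocalRing.maximalIdeal R) :
    (𝔐 / 𝔐) / ((𝔐 / 𝔐) / 𝔐) = 𝔐 := by
  obtain ⟨u, hu⟩ := isUnit_algebraMap_fractionRing hr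
  apply le_antisymm
  · intro z hz
    have := hz _ (fun y hy => mul_comm y _ ▸ mul_inv_mem_div_of_sq_eq h hu hy) _
      (hu ▸ algebraMap_mem_idl.2 hrm)
    rwa [mul_assoc, Units.inv_mul, mul_one] at this
  · intro z hz w hw
    rw [mul_comm]
    exact hw z hz

theorem one_div_one_div_eq_of_sq_eq {r : R} (hr : r ∈ R⁰) (hrm : r ∈ IsLocalRing.maximalIdeal R)
    (h : IsLocalRing.maximalIdeal R ^ 2 = Ideal.span {r} * IsLocalRing.maximalIdeal R)
    (hM : 1 / 𝔐 = 𝔐 / 𝔐) {I : Submodule R (FractionRing R)}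
    (hI : ¬∃ x, I = Submodule.span R {x}) :
    1 / (1 / I) = (𝔐 / 𝔐) / ((𝔐 / 𝔐) / I) := by
  obtain ⟨u, hu⟩ := isUnit_algebraMap_fractionRing hr
  have huM : (u : FractionRing R) ∈ 𝔐 := hu ▸ algebraMap_mem_idl.2 hrm
  apply le_antisymm
  · intro w hw l hl
    rw [← hM]
    intro y hy
    rw [mul_assoc]
    refine hw _ fun i hi => idl_le_one (IsLocalRing.maximalIdeal R) ?_
    rw [mul_right_comm]
    exact hl i hi y hy
  · intro w hw z hz
    have hz' := one_div_le_div_of_not_principal hI hz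
    have hl : z * ↑u⁻¹ ∈ (𝔐 / 𝔐) / I := fun i hi => by
      rw [mul_right_comm]
      exact mul_inv_mem_div_of_sq_eq h hu (hz' i hi)
    simpa [mul_assoc] using idl_le_one _ (hw _ hl _ huM)

theorem le_div_self_of_one_div_one_div_eq {I : Submodule R (FractionRing R)}
    (hI : ¬∃ x, I = Submodule.span R {x}) (hrefl : 1 / (1 / I) = I) : 𝔐 / 𝔐 ≤ I / I := by
  intro b hb i hi
  rw [← hrefl]
  intro z hz
  have := hb _ (one_div_le_div_of_not_principal hI hz i hi)
  rw [mul_assoc, mul_comm i]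
  exact idl_le_one _ this

theorem one_div_one_div_maximalIdeal [IsNoetherianRing R] [Ring.KrullDimLE 1 R] {a : R} (ha : a ∈ R⁰)
    (ham : a ∈ IsLocalRing.maximalIdeal R) : 1 / (1 / 𝔐) = 𝔐 := by
  apply le_antisymm
  · intro z hz
    have h1 : (1 : FractionRing R) ∈ 1 / 𝔐 := fun y hy => by
      rw [one_mul]
      exact idl_le_one _ hy
    obtain ⟨s, hs⟩ := Submodule.mem_one.1 (mul_one z ▸ hz 1 h1)
    refine ⟨s, ?_, hs⟩
    change s ∈ IsLocalRing.maximalIdeal R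
    by_contra hsm
    obtain ⟨v, rfl⟩ := IsLocalRing.notMem_maximalIdeal.1 hsm
    obtain ⟨q, hq, hqm⟩ := exists_notMem_range_forall_mul_mem (R := R) (B := R)
      (Q := FractionRing R) (IsFractionRing.injective R _) ha (isUnit_algebraMap_fractionRing ha)
      (Ideal.IsPrime.ne_top') ham
    have hq' : q ∈ 1 / 𝔐 := by
      rintro _ ⟨y, hy, rfl⟩
      exact Submodule.mem_one.2 (hqm y hy)
    obtain ⟨t, ht⟩ := Submodule.mem_one.1 (hz q hq')
    refine hq ⟨↑v⁻¹ * t, ?_⟩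
    rw [map_mul, ht, ← hs, ← mul_assoc, ← map_mul, Units.inv_mul, map_one, one_mul]
  · intro z hz w hw
    rw [mul_comm]
    exact hw z hz

theorem exists_sq_eq_of_div_div_maximalIdeal [IsNoetherianRing R] [Ring.KrullDimLE 1 R] {a : R}
    (ha : a ∈ R⁰) (ham : a ∈ IsLocalRing.maximalIdeal R)
    (h : (𝔐 / 𝔐) / ((𝔐 / 𝔐) / 𝔐) = 𝔐) :
    ∃ x ∈ IsLocalRing.maximalIdeal R,
      IsLocalRing.maximalIdeal R ^ 2 = Ideal.span {x} * IsLocalRing.maximalIdeal R := by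
  let B := multiplierRing 𝔐
  have haM : algebraMap R (FractionRing R) a ∈ 𝔐 := algebraMap_mem_idl.2 ham
  have : Module.Finite R B := finite_multiplierRing (idl_le_one _) ha haM
  have hMB : ∀ y ∈ 𝔐, y ∈ 𝔐 / 𝔐 := fun y hy => one_le_div_self _ (idl_le_one _ hy)
  let M : Submodule B (FractionRing R) :=
    { (𝔐).toAddSubmonoid with smul_mem' := fun b y hy => b.2 y hy }
  let J : Submodule B (FractionRing R) :=
    { ((𝔐 / 𝔐) / 𝔐).toAddSubmonoid with
      smul_mem' := fun b y hy m hm => by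
        change ↑b * y * m ∈ _
        rw [mul_assoc]
        exact B.mul_mem b.2 (hy m hm) }
  have hle1 {z : FractionRing R} (hz : z ∈ 𝔐 / 𝔐) : z ∈ (1 : Submodule B (FractionRing R)) :=
    Submodule.mem_one.2 ⟨⟨z, hz⟩, rfl⟩
  have hM1 : M ≤ 1 := fun y hy => hle1 (hMB y hy)
  have h1J : (1 : FractionRing R) ∈ J := fun y hy => by
    rw [one_mul]
    exact hMB y hy
  have hMJ : M * J = 1 := by
    apply le_antisymm
    · refine Submodule.mul_le.2 fun m hm j hj => hle1 ?_
      rw [mul_comm]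
      exact hj m hm
    · by_contra hne
      let K : Ideal B := (M * J).comap (Algebra.linearMap B (FractionRing R))
      have hK : K ≠ ⊤ := by
        rw [Ne, Ideal.eq_top_iff_one]
        intro h1
        refine hne (Submodule.one_le.2 ?_)
        simpa [K] using h1
      have haK : algebraMap R B a ∈ K := by
        change algebraMap R (FractionRing R) a ∈ M * J
        exact mul_one (algebraMap R (FractionRing R) a) ▸ Submodule.mul_mem_mul haM h1J
      obtain ⟨q, hq, hqK⟩ := exists_notMem_range_forall_mul_mem (R := R) (B := B)
        (Q := FractionRing R) Subtype.coe_injective ha (isUnit_algebraMap_fractionRing ha) hK haK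
      have hqB : q ∈ 𝔐 / 𝔐 := by
        intro m hm
        rw [← h]
        intro j hj
        have hmj : m * j ∈ 𝔐 / 𝔐 := mul_comm j m ▸ hj m hm
        obtain ⟨b, hb⟩ := hqK ⟨m * j, hmj⟩ (Submodule.mul_mem_mul (M := M) (N := J) hm hj)
        rw [mul_assoc]
        exact hb ▸ b.2
      exact hq ⟨⟨q, hqB⟩, rfl⟩
  obtain ⟨x, hx⟩ := exists_eq_span_singleton_of_mul_eq_one B M J ha hM1 haM hMJ
  have hxM : x ∈ M := hx ▸ Submodule.mem_span_singleton_self x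
  obtain ⟨r, hr, rfl⟩ := hxM
  refine ⟨r, hr, sq_eq_span_singleton_mul hr fun y hy => ?_⟩
  have hyM : y ∈ M := hy
  rw [hx] at hyM
  obtain ⟨b, rfl⟩ := Submodule.mem_span_singleton.1 hyM
  exact ⟨b, b.2, rfl⟩

end MinimalMultiplicity

theorem statement_17
    (R : Type*) [CommRing R] [IsNoetherianRing R] [IsLocalRing R] [IsReduced R]
    (hdim : ringKrullDim R = 1)
    (hCM : ∃ x ∈ IsLocalRing.maximalIdeal R, x ∈ R⁰)
    [Infinite (IsLocalRing.ResidueField R)]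
    (hfin : (Subalgebra.toSubmodule (integralClosure R (FractionRing R))).FG)
    :
    ((∃ x ∈ IsLocalRing.maximalIdeal R,
        IsLocalRing.maximalIdeal R ^ 2 = Ideal.span {x} * IsLocalRing.maximalIdeal R) ↔
      (∀ I : Submodule R (FractionRing R), IsFracIdeal I →
        (¬∃ x : FractionRing R, I = Submodule.span R {x}) →
        (((1 : Submodule R (FractionRing R)) / (1 / I) = I) ↔
          (idl R (IsLocalRing.maximalIdeal R) / idl R (IsLocalRing.maximalIdeal R) ≤ I / I ∧
            (idl R (IsLocalRing.maximalIdeal R) / idl R (IsLocalRing.maximalIdeal R)) /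
              ((idl R (IsLocalRing.maximalIdeal R) / idl R (IsLocalRing.maximalIdeal R)) / I) =
              I)))) ∧
    ((∃ x ∈ IsLocalRing.maximalIdeal R,
        IsLocalRing.maximalIdeal R ^ 2 = Ideal.span {x} * IsLocalRing.maximalIdeal R) ↔
      (idl R (IsLocalRing.maximalIdeal R) / idl R (IsLocalRing.maximalIdeal R)) /
          ((idl R (IsLocalRing.maximalIdeal R) / idl R (IsLocalRing.maximalIdeal R)) /
            idl R (IsLocalRing.maximalIdeal R)) =
        idl R (IsLocalRing.maximalIdeal R)) := by
  obtain ⟨a, ham, ha⟩ := hCM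
  have : Ring.KrullDimLE 1 R := by
    rw [Ring.KrullDimLE, Order.krullDimLE_iff]
    exact hdim.le
  have haM := MinimalMultiplicity.algebraMap_mem_idl.2 ham
  obtain ⟨u, hu⟩ := MinimalMultiplicity.isUnit_algebraMap_fractionRing ha
  refine ⟨⟨?_, fun h => ?_⟩, ?_,
    MinimalMultiplicity.exists_sq_eq_of_div_div_maximalIdeal ha ham⟩
  · rintro ⟨r, hrm, hsq⟩ I - hI
    have hr := MinimalMultiplicity.mem_nonZeroDivisors_of_sq_eq ha ham hsq
    by_cases hM : ∃ x, idl R (IsLocalRing.maximalIdeal R) = Submodule.span R {x}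
    · obtain ⟨x, hx⟩ := hM
      rw [MinimalMultiplicity.div_self_eq_one_of_eq_span_singleton (hu ▸ haM) hx]
      exact (and_iff_right (MinimalMultiplicity.one_le_div_self I)).symm
    · have hM' : 1 / idl R (IsLocalRing.maximalIdeal R) =
          idl R (IsLocalRing.maximalIdeal R) / idl R (IsLocalRing.maximalIdeal R) :=
        le_antisymm (MinimalMultiplicity.one_div_le_div_of_not_principal hM)
          fun z hz y hy => MinimalMultiplicity.idl_le_one _ (hz y hy)
      constructor
      · intro hrefl
        have hBI := MinimalMultiplicity.le_div_self_of_one_div_one_div_eq hI hrefl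
        refine ⟨hBI, ?_⟩
        rw [← MinimalMultiplicity.one_div_one_div_eq_of_sq_eq hr hrm hsq hM' hI, hrefl]
      · rintro ⟨-, hrefl⟩
        rw [MinimalMultiplicity.one_div_one_div_eq_of_sq_eq hr hrm hsq hM' hI, hrefl]
  · by_cases hM : ∃ x, idl R (IsLocalRing.maximalIdeal R) = Submodule.span R {x}
    · obtain ⟨x, hx⟩ := hM
      have hxM : x ∈ idl R (IsLocalRing.maximalIdeal R) :=
        hx ▸ Submodule.mem_span_singleton_self x
      obtain ⟨r, hr, rfl⟩ := hxM
      refine ⟨r, hr, MinimalMultiplicity.sq_eq_span_singleton_mul hr fun y hy => ?_⟩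
      rw [hx] at hy
      obtain ⟨s, rfl⟩ := Submodule.mem_span_singleton.1 hy
      exact ⟨algebraMap R _ s, MinimalMultiplicity.one_le_div_self _
        (Submodule.mem_one.2 ⟨s, rfl⟩), Algebra.smul_def _ _⟩
    · refine MinimalMultiplicity.exists_sq_eq_of_div_div_maximalIdeal ha ham
        ((h _ ⟨⟨u, hu ▸ haM⟩, 1, one_mem _, ?_⟩ hM).1
          (MinimalMultiplicity.one_div_one_div_maximalIdeal ha ham)).2
      rw [smulQ, map_one, ← Submodule.one_eq_span, one_mul]
      exact MinimalMultiplicity.idl_le_one _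
  · rintro ⟨r, hrm, hsq⟩
    exact MinimalMultiplicity.div_div_maximalIdeal_of_sq_eq
      (MinimalMultiplicity.mem_nonZeroDivisors_of_sq_eq ha ham hsq) hrm hsq
end
end

section
/- Let I ⊆ J be two proper regular ideals of R both containing the conductor C. If J = αI for some regular element α ∈ Q(R), then I = J. -/
open scoped nonZeroDivisors

noncomputable section

theorem mem_smulQ {R : Type*} [CommRing R] {z x : FractionRing R}
    {M : Submodule R (FractionRing R)} : x ∈ smulQ z M ↔ ∃ y ∈ M, z * y = x :=
  Submodule.mem_span_singleton_mul

theorem mem_idl {R : Type*} [CommRing R] {I : Ideal R} {x : FractionRing R} :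
    x ∈ idl R I ↔ ∃ r ∈ I, algebraMap R (FractionRing R) r = x :=
  Iff.rfl

theorem mem_condC {R : Type*} [CommRing R] {x : FractionRing R} :
    x ∈ condC R ↔ ∀ y ∈ Rbar R, x * y ∈ (1 : Submodule R (FractionRing R)) :=
  Submodule.mem_div_iff_forall_mul_mem

theorem mul_mem_condC {R : Type*} [CommRing R] {x y : FractionRing R}
    (hx : x ∈ condC R) (hy : y ∈ Rbar R) : x * y ∈ condC R :=
  mem_condC.2 fun z hz => by
    rw [mul_assoc]
    exact mem_condC.1 hx _ ((integralClosure R (FractionRing R)).mul_mem hy hz)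

theorem exists_regular_mem_condC {R : Type*} [CommRing R] (hfin : (Rbar R).FG) :
    ∃ c ∈ R⁰, algebraMap R (FractionRing R) c ∈ condC R := by
  obtain ⟨c, hc, h⟩ := FractionalIdeal.isFractional_of_fg (S := R⁰) hfin
  refine ⟨c, hc, mem_condC.2 fun y hy => ?_⟩
  obtain ⟨r, hr⟩ := h y hy
  exact Submodule.mem_one.2 ⟨r, by rw [hr, Algebra.smul_def]⟩

/-- If multiplication by `z` maps the conductor into `R`, it maps the conductor into itself. -/
theorem mul_mem_condC_of_forall_mem_one {R : Type*} [CommRing R] {z : FractionRing R}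
    (hz : ∀ x ∈ condC R, z * x ∈ (1 : Submodule R (FractionRing R)))
    {x : FractionRing R} (hx : x ∈ condC R) : z * x ∈ condC R :=
  mem_condC.2 fun y hy => by
    rw [mul_assoc]
    exact hz _ (mul_mem_condC hx hy)

theorem condC_le_one {R : Type*} [CommRing R] : condC R ≤ 1 := fun x hx => by
  simpa using mem_condC.1 hx 1 (integralClosure R (FractionRing R)).one_mem

/-- In a noetherian ring, `I ⊆ αI` is an equality as soon as all the `α ^ n * c` lie in `R` for
some regular `c`. -/
theorem smulQ_le_of_le_smulQ {R : Type*} [CommRing R] [IsNoetherianRing R] {I : Ideal R}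
    {α c : (FractionRing R)ˣ} (hI : idl R I ≤ smulQ (α : FractionRing R) (idl R I))
    (hc : ∀ n : ℕ, (α : FractionRing R) ^ n * c ∈ (1 : Submodule R (FractionRing R))) :
    smulQ (α : FractionRing R) (idl R I) ≤ idl R I := by
  let K : ℕ →o Ideal R :=
    { toFun := fun n => Submodule.comap (Algebra.linearMap R (FractionRing R))
        (smulQ ((α : FractionRing R) ^ n * c) (idl R I))
      monotone' := monotone_nat_of_le_succ fun n r hr => by
        obtain ⟨y, hy, hyr⟩ := mem_smulQ.1 hr
        obtain ⟨w, hw, rfl⟩ := mem_smulQ.1 (hI hy)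
        exact mem_smulQ.2 ⟨w, hw, by rw [← hyr]; ring⟩ }
  obtain ⟨n, hn⟩ := monotone_stabilizes_iff_noetherian.2 ‹IsNoetherian R R› K
  intro x hx
  obtain ⟨y, hy, rfl⟩ := mem_smulQ.1 hx
  obtain ⟨s, hs⟩ := Submodule.mem_one.1 (hc (n + 1))
  obtain ⟨t, ht, rfl⟩ := mem_idl.1 hy
  have hmem : s * t ∈ K (n + 1) :=
    mem_smulQ.2 ⟨_, hy, by rw [← hs, Algebra.linearMap_apply, map_mul]⟩
  rw [← hn (n + 1) n.le_succ] at hmem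
  obtain ⟨z, hz, hzx⟩ := mem_smulQ.1 hmem
  rw [Algebra.linearMap_apply, map_mul, hs, pow_succ, mul_assoc, mul_assoc, mul_assoc] at hzx
  have hzx' := (α ^ n * c).isUnit.mul_left_cancel (b := z)
    (c := α * algebraMap R (FractionRing R) t) (by push_cast; linear_combination hzx)
  rwa [← hzx']

theorem statement_18
    (R : Type*) [CommRing R] [IsNoetherianRing R] [IsLocalRing R] [IsReduced R]
    (hdim : ringKrullDim R = 1)
    (hCM : ∃ x ∈ IsLocalRing.maximalIdeal R, x ∈ R⁰)
    [Infinite (IsLocalRing.ResidueField R)]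
    (hfin : (Subalgebra.toSubmodule (integralClosure R (FractionRing R))).FG)
    (I J : Ideal R)
    (hIreg : ∃ r ∈ I, r ∈ R⁰) (hJreg : ∃ r ∈ J, r ∈ R⁰)
    (hIproper : I ≠ ⊤) (hJproper : J ≠ ⊤)
    (hCI : condC R ≤ idl R I) (hCJ : condC R ≤ idl R J)
    (hIJ : I ≤ J)
    (α : (FractionRing R)ˣ)
    (hα : idl R J = smulQ (α : FractionRing R) (idl R I)) :
    I = J := by
  have hαC : ∀ x ∈ condC R, (α : FractionRing R) * x ∈ condC R := fun x hx =>
    mul_mem_condC_of_forall_mem_one (fun y hy => by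
      have hmem : (α : FractionRing R) * y ∈ idl R J := hα ▸ mem_smulQ.2 ⟨y, hCI hy, rfl⟩
      obtain ⟨r, -, hr⟩ := mem_idl.1 hmem
      exact Submodule.mem_one.2 ⟨r, hr⟩) hx
  obtain ⟨c, hc, hcC⟩ := exists_regular_mem_condC hfin
  let u := (IsLocalization.map_units (FractionRing R) (⟨c, hc⟩ : R⁰)).unit
  have hpow : ∀ n : ℕ, (α : FractionRing R) ^ n * u ∈ condC R := by
    intro n
    induction n with
    | zero => simpa [u] using hcC
    | succ n ih =>
      rw [pow_succ', mul_assoc]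
      exact hαC _ ih
  have hle : idl R J ≤ idl R I := by
    rw [hα]
    exact smulQ_le_of_le_smulQ (hα ▸ Submodule.map_mono hIJ) fun n => condC_le_one (hpow n)
  refine le_antisymm hIJ fun r hr => ?_
  obtain ⟨s, hs, hsr⟩ := mem_idl.1 (hle (mem_idl.2 ⟨r, hr, rfl⟩))
  rwa [← IsFractionRing.injective R (FractionRing R) hsr]
end
end
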